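/- Let T be an operator assigning to each m-tuple of bounded compactly supported measurable functions on ℝ^d a measurable function, and suppose T satisfies sparse form domination with constant C_T. Let p⃗ ∈ [1,∞]^m, let p ∈ [1/m,∞) be given by 1/p = Σ_{j=1}^m 1/p_j, let w⃗ ∈ A_{p⃗} with w := ∏_{j=1}^m w_j, and let θ ∈ (0,1] with θ < p. Suppose N ∈ [0,∞) is such that for every (2·6^d)^{-1}-sparse collection S contained in some dyadic grid and all bounded compactly supported measurable f_1,…,f_m one has ‖A^θ_S f⃗‖_{L^{p,∞}_w(ℝ^d)} ≤ N ∏_{j=1}^m ‖f_j‖_{L^{p_j}_{w_j}(ℝ^d)}. Then there is a constant c, depending only on d, m, p⃗ and C_T, such that for all bounded compactly supported measurable f_1,…,f_m, ‖T f⃗‖_{L^{p,∞}_w(ℝ^d)} ≤ c · (1 − θ/p)^{-1} · [w⃗]_{p⃗}^{1−θ} · N^θ · ∏_{j=1}^m ‖f_j‖_{L^{p_j}_{w_j}(ℝ^d)}. -/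

import Mathlib

open MeasureTheory ENNReal Set

noncomputable section

namespace Paper

variable {d m : ℕ}

abbrev Rd (d : ℕ) := Fin d → ℝ

structure Cube (d : ℕ) where
  corner : Rd d
  side : ℝ
  side_pos : 0 < side

def Cube.set (Q : Cube d) : Set (Rd d) :=
  {x | ∀ i, Q.corner i ≤ x i ∧ x i < Q.corner i + Q.side}

/-- the average `⟨f⟩_{q,Q}` for finite exponent `q`, of an `ℝ≥0∞`-valued function -/
def eAvg (f : Rd d → ℝ≥0∞) (q : ℝ) (Q : Cube d) : ℝ≥0∞ :=
  ((volume Q.set)⁻¹ * ∫⁻ x in Q.set, f x ^ q) ^ (1 / q)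

def ofFn (f : Rd d → ℝ) : Rd d → ℝ≥0∞ := fun x => ENNReal.ofReal |f x|

/-- the average `⟨f⟩_{q,Q}` for finite exponent `q > 0` -/
def avg (f : Rd d → ℝ) (q : ℝ) (Q : Cube d) : ℝ≥0∞ := eAvg (ofFn f) q Q

/-- the average `⟨f⟩_{q,Q}` for exponent `q ∈ (0,∞]` -/
def avgE (f : Rd d → ℝ) (q : ℝ≥0∞) (Q : Cube d) : ℝ≥0∞ :=
  if q = ∞ then essSup (ofFn f) (volume.restrict Q.set) else avg f q.toReal Q

def IsWeight (u : Rd d → ℝ) : Prop :=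
  MeasureTheory.LocallyIntegrable u volume ∧ ∀ᵐ x ∂(volume : Measure (Rd d)), 0 < u x

/-- `u(A) = ∫_A u dx` -/
def wMeas (u : Rd d → ℝ) (A : Set (Rd d)) : ℝ≥0∞ := ∫⁻ x in A, ENNReal.ofReal (u x)

/-- the Hardy–Littlewood maximal operator -/
def maximal (f : Rd d → ℝ) (x : Rd d) : ℝ≥0∞ :=
  ⨆ (Q : Cube d) (_ : x ∈ Q.set), avg f 1 Q

/-- the Fujii–Wilson constant `[u]_FW` -/
def FW (u : Rd d → ℝ) : ℝ≥0∞ :=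
  ⨆ Q : Cube d, (wMeas u Q.set)⁻¹ * ∫⁻ x in Q.set, maximal (Q.set.indicator u) x

/-- Hölder conjugate in `ℝ≥0∞` -/
def conj (q : ℝ≥0∞) : ℝ≥0∞ := (1 - q⁻¹)⁻¹

def prodW (w : Fin m → Rd d → ℝ) : Rd d → ℝ := fun x => ∏ j, w j x

/-- the two-weight multilinear Muckenhoupt constant `[w⃗,ω]_{p⃗}`; here `p0` is the
real number with `1/p0 = ∑ 1/p j`. -/
def APtw (p0 : ℝ) (p : Fin m → ℝ≥0∞) (w : Fin m → Rd d → ℝ) (ω : Rd d → ℝ) : ℝ≥0∞ :=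
  ⨆ Q : Cube d, avg ω p0 Q * ∏ j, avgE (fun x => (w j x)⁻¹) (conj (p j)) Q

/-- the multilinear Muckenhoupt constant `[w⃗]_{p⃗}` -/
def AP (p0 : ℝ) (p : Fin m → ℝ≥0∞) (w : Fin m → Rd d → ℝ) : ℝ≥0∞ :=
  APtw p0 p w (prodW w)

def IsSparse (η : ℝ) (S : Set (Cube d)) : Prop :=
  ∃ E : Cube d → Set (Rd d),
    (∀ Q ∈ S, E Q ⊆ Q.set ∧ MeasurableSet (E Q) ∧
      ENNReal.ofReal η * volume Q.set ≤ volume (E Q)) ∧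
    S.PairwiseDisjoint E

def dyadicGrid (d : ℕ) (α : Rd d) : Set (Cube d) :=
  {Q | ∃ (j : ℤ) (k : Fin d → ℤ),
    Q.side = (2:ℝ) ^ (-j) ∧ ∀ i, Q.corner i = (2:ℝ) ^ (-j) * (α i + k i)}

def IsDyadicGrid (D : Set (Cube d)) : Prop :=
  ∃ α : Rd d, (∀ i, α i = 0 ∨ α i = 1/3 ∨ α i = 2/3) ∧ D = dyadicGrid d α

/-- bounded, compactly supported, measurable -/
def BCS (f : Rd d → ℝ) : Prop :=
  Measurable f ∧ (∃ C, ∀ x, |f x| ≤ C) ∧ HasCompactSupport f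

def sparseForm (S : Set (Cube d)) (f : Fin m → Rd d → ℝ) (g : Rd d → ℝ) : ℝ≥0∞ :=
  ∑' Q : S, (∏ j, avg (f j) 1 Q.1) * avg g 1 Q.1 * volume (Q.1).set

def SparseFormDom (T : (Fin m → Rd d → ℝ) → Rd d → ℝ) (CT : ℝ≥0∞) : Prop :=
  ∀ (f : Fin m → Rd d → ℝ) (g : Rd d → ℝ), (∀ j, BCS (f j)) → BCS g →
    ∃ S : Set (Cube d), IsSparse (1/2) S ∧
      (∫⁻ x, ofFn (T f) x * ofFn g x) ≤ CT * sparseForm S f g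

/-- `‖f‖_{L^{p,∞}_u} = sup_{λ>0} λ (u^p({f > λ}))^{1/p}` for `ℝ≥0∞`-valued `f` -/
def eWeakNorm (u : Rd d → ℝ) (p : ℝ) (f : Rd d → ℝ≥0∞) : ℝ≥0∞ :=
  ⨆ (l : ℝ) (_ : 0 < l), ENNReal.ofReal l *
    (∫⁻ x in {x | ENNReal.ofReal l < f x}, ENNReal.ofReal (u x) ^ p) ^ (1/p)

def weakNorm (u : Rd d → ℝ) (p : ℝ) (f : Rd d → ℝ) : ℝ≥0∞ := eWeakNorm u p (ofFn f)

/-- `‖f‖_{L^p_u} = ‖fu‖_{L^p}` -/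
def LpW (u : Rd d → ℝ) (p : ℝ≥0∞) (f : Rd d → ℝ) : ℝ≥0∞ :=
  eLpNorm (fun x => f x * u x) p volume

/-- `A^θ_S f⃗ := (Σ_{Q∈S} (∏_j ⟨f_j⟩_{1,Q})^θ 1_Q)^{1/θ}` -/
def ASparsePow (S : Set (Cube d)) (θ : ℝ) (f : Fin m → Rd d → ℝ) (x : Rd d) : ℝ≥0∞ :=
  (∑' Q : S, (∏ j, avg (f j) 1 Q.1) ^ θ *
      (Q.1).set.indicator (fun _ => (1 : ℝ≥0∞)) x) ^ (1 / θ)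

theorem Cube.set_eq_pi (Q : Cube d) :
    Q.set = Set.pi univ fun i => Ico (Q.corner i) (Q.corner i + Q.side) := by
  ext x
  simp [Cube.set, Set.mem_pi]

theorem Cube.measurableSet_set (Q : Cube d) : MeasurableSet Q.set := by
  rw [Q.set_eq_pi]
  exact MeasurableSet.univ_pi fun _ => measurableSet_Ico

theorem Cube.volume_set (Q : Cube d) : volume Q.set = ENNReal.ofReal Q.side ^ d := by
  rw [Q.set_eq_pi, volume_pi_pi]
  simp

theorem Cube.volume_set_ne_zero (Q : Cube d) : volume Q.set ≠ 0 := by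
  rw [Q.volume_set]
  exact pow_ne_zero _ (by simpa using Q.side_pos)

theorem Cube.volume_set_ne_top (Q : Cube d) : volume Q.set ≠ ∞ := by
  rw [Q.volume_set]
  exact pow_ne_top ofReal_ne_top

theorem Cube.volume_set_le_of_side_le {Q R : Cube d} {k : ℕ} (h : R.side ≤ k * Q.side) :
    volume R.set ≤ (k : ℝ≥0∞) ^ d * volume Q.set := by
  rw [Q.volume_set, R.volume_set, ← mul_pow]
  gcongr
  calc ENNReal.ofReal R.side ≤ ENNReal.ofReal (k * Q.side) := ofReal_le_ofReal h
    _ = k * ENNReal.ofReal Q.side := by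
      rw [ofReal_mul (by positivity), ofReal_natCast]

theorem avg_one (f : Rd d → ℝ) (Q : Cube d) :
    avg f 1 Q = (volume Q.set)⁻¹ * ∫⁻ x in Q.set, ofFn f x := by
  simp [avg, eAvg]

theorem avg_one_mul_volume (f : Rd d → ℝ) (Q : Cube d) :
    avg f 1 Q * volume Q.set = ∫⁻ x in Q.set, ofFn f x := by
  rw [avg_one, mul_right_comm, ENNReal.inv_mul_cancel Q.volume_set_ne_zero Q.volume_set_ne_top,
    one_mul]

theorem inv_volume_le_of_volume_le {Q R : Cube d} {K : ℝ≥0∞}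
    (h : volume R.set ≤ K * volume Q.set) : (volume Q.set)⁻¹ ≤ K * (volume R.set)⁻¹ := by
  rw [← div_eq_mul_inv, ENNReal.le_div_iff_mul_le (Or.inl R.volume_set_ne_zero)
    (Or.inl R.volume_set_ne_top), mul_comm, ← div_eq_mul_inv]
  exact ENNReal.div_le_of_le_mul h

theorem avg_one_le_of_subset {f : Rd d → ℝ} {Q R : Cube d} {K : ℝ≥0∞}
    (hQR : Q.set ⊆ R.set) (h : volume R.set ≤ K * volume Q.set) :
    avg f 1 Q ≤ K * avg f 1 R := by
  rw [avg_one, avg_one, ← mul_assoc]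
  gcongr
  exact inv_volume_le_of_volume_le h

/-- The translation vector in `{0, 1/3}^d` encoded by `β`. -/
def gridShift (β : Fin d → Bool) : Rd d := fun i => if β i then 1 / 3 else 0

theorem isDyadicGrid_gridShift (β : Fin d → Bool) :
    IsDyadicGrid (dyadicGrid d (gridShift β)) :=
  ⟨_, fun i => by by_cases h : β i <;> simp [gridShift, h], rfl⟩

theorem exists_shifted_interval (a s L : ℝ) (hL : 0 < L) (hs : 3 * s ≤ L) :
    ∃ (b : Bool) (k : ℤ), L * ((if b then 1 / 3 else 0) + k) ≤ a ∧
      a + s ≤ L * ((if b then 1 / 3 else 0) + k) + L := by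
  have h1 := Int.floor_le (a / L)
  have h2 := Int.lt_floor_add_one (a / L)
  have ha : a = L * (a / L) := by field_simp
  generalize a / L = t at *
  subst ha
  by_cases h : L * t + s ≤ L * (⌊t⌋ + 1)
  · exact ⟨false, ⌊t⌋, by simp only [Bool.false_eq_true, if_false]; nlinarith,
      by simp only [Bool.false_eq_true, if_false]; nlinarith⟩
  · exact ⟨true, ⌊t⌋, by simp only [if_true]; nlinarith, by simp only [if_true]; nlinarith⟩

theorem exists_dyadic_cover (Q : Cube d) :
    ∃ (β : Fin d → Bool) (R : Cube d), R ∈ dyadicGrid d (gridShift β) ∧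
      Q.set ⊆ R.set ∧ R.side ≤ 6 * Q.side := by
  obtain ⟨n, hn1, hn2⟩ := exists_mem_Ioc_zpow (x := 3 * Q.side) (y := (2 : ℝ))
    (by linarith [Q.side_pos]) one_lt_two
  have hL : (0 : ℝ) < 2 ^ (n + 1) := by positivity
  choose b k hk1 hk2 using fun i => exists_shifted_interval (Q.corner i) Q.side _ hL hn2
  refine ⟨b, ⟨fun i => 2 ^ (n + 1) * ((if b i then 1 / 3 else 0) + k i), 2 ^ (n + 1), hL⟩,
    ⟨-(n + 1), k, by simp, fun i => by simp [gridShift]⟩, ?_, ?_⟩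
  · intro x hx i
    exact ⟨(hk1 i).trans (hx i).1, (hx i).2.trans_le (hk2 i)⟩
  · change (2 : ℝ) ^ (n + 1) ≤ _
    rw [zpow_add_one₀ two_ne_zero]
    linarith

theorem countable_dyadicGrid (α : Rd d) : (dyadicGrid d α).Countable := by
  have : dyadicGrid d α ⊆ range fun q : ℤ × (Fin d → ℤ) =>
      (⟨fun i => (2 : ℝ) ^ (-q.1) * (α i + q.2 i), (2 : ℝ) ^ (-q.1), by positivity⟩ : Cube d) := by
    rintro ⟨c, s, hs⟩ ⟨j, k, h1, h2⟩
    refine ⟨(j, k), ?_⟩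
    simp only [Cube.mk.injEq]
    exact ⟨funext fun i => (h2 i).symm, h1.symm⟩
  exact (countable_range _).mono this

theorem tsum_one_le_of_disjoint {ι : Type*} (c : ι → Cube d) (E : ι → Set (Rd d)) (R : Cube d)
    {K : ℝ≥0∞} (hcR : ∀ i, (c i).set ⊆ R.set) (hRc : ∀ i, volume R.set ≤ K * volume (c i).set)
    (hEc : ∀ i, E i ⊆ (c i).set) (hE : ∀ i, MeasurableSet (E i))
    (hcE : ∀ i, volume (c i).set ≤ 2 * volume (E i))
    (hdisj : Pairwise (Function.onFun Disjoint E)) :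
    ∑' _ : ι, (1 : ℝ≥0∞) ≤ 2 * K := by
  have h : (∑' _ : ι, (1 : ℝ≥0∞)) * volume R.set ≤ 2 * K * volume R.set := by
    calc (∑' _ : ι, (1 : ℝ≥0∞)) * volume R.set = ∑' _ : ι, volume R.set := by
          rw [← ENNReal.tsum_mul_right]; simp
      _ ≤ ∑' i, 2 * K * volume (E i) := by
          refine ENNReal.tsum_le_tsum fun i => (hRc i).trans ?_
          rw [mul_comm 2 K, mul_assoc]
          gcongr
          exact hcE i
      _ = 2 * K * ∑' i, volume (E i) := ENNReal.tsum_mul_left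
      _ ≤ 2 * K * volume R.set := by
          gcongr
          exact (tsum_meas_le_meas_iUnion_of_disjoint volume hE hdisj).trans
            (measure_mono (iUnion_subset fun i => (hEc i).trans (hcR i)))
  exact (ENNReal.mul_le_mul_iff_left R.volume_set_ne_zero R.volume_set_ne_top).1 h

theorem IsSparse.image {S : Set (Cube d)} (hS : IsSparse (1 / 2) S) {c : Cube d → Cube d}
    (hsub : ∀ Q, Q.set ⊆ (c Q).set) (hvol : ∀ Q, volume (c Q).set ≤ 6 ^ d * volume Q.set)
    {S' : Set (Cube d)} (hS' : S' ⊆ S) : IsSparse ((2 * 6 ^ d : ℝ))⁻¹ (c '' S') := by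
  classical
  obtain ⟨E, hE, hdisj⟩ := hS
  choose! q hq hcq using fun R (hR : R ∈ c '' S') => hR
  refine ⟨fun R => E (q R), fun R hR => ?_, fun R hR R' hR' hne => ?_⟩
  · obtain ⟨h1, h2, h3⟩ := hE _ (hS' (hq R hR))
    have h4 := hsub (q R)
    have h5 := hvol (q R)
    rw [hcq R hR] at h4 h5
    refine ⟨h1.trans h4, h2, le_trans ?_ h3⟩
    calc ENNReal.ofReal (2 * 6 ^ d)⁻¹ * volume R.set
        ≤ ENNReal.ofReal (2 * 6 ^ d)⁻¹ * (6 ^ d * volume (q R).set) := by gcongr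
      _ = ENNReal.ofReal (1 / 2) * volume (q R).set := by
        rw [← mul_assoc]
        congr 1
        rw [show (6 : ℝ≥0∞) ^ d = ENNReal.ofReal (6 ^ d) by
          rw [ofReal_pow (by norm_num)]; norm_num, ← ofReal_mul (by positivity)]
        congr 1
        field_simp
  · refine hdisj (hS' (hq R hR)) (hS' (hq R' hR')) fun h => hne ?_
    rw [← hcq R hR, ← hcq R' hR', h]

theorem exists_dyadic_sparse {S : Set (Cube d)} (hS : IsSparse (1 / 2) S) :
    ∃ 𝒮 : (Fin d → Bool) → Set (Cube d),
      (∀ β, 𝒮 β ⊆ dyadicGrid d (gridShift β)) ∧ (∀ β, IsSparse ((2 * 6 ^ d : ℝ))⁻¹ (𝒮 β)) ∧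
      ∀ (f : Fin m → Rd d → ℝ) (g : Rd d → ℝ), sparseForm S f g ≤
        (6 ^ d) ^ m * (2 * 6 ^ d) *
          ∑ β, ∑' R : 𝒮 β, (∏ j, avg (f j) 1 R.1) * ∫⁻ x in R.1.set, ofFn g x := by
  classical
  choose β c hgrid hsub hside using exists_dyadic_cover (d := d)
  have hvol (Q : Cube d) : volume (c Q).set ≤ 6 ^ d * volume Q.set :=
    Cube.volume_set_le_of_side_le (k := 6) (by exact_mod_cast hside Q)
  refine ⟨fun b => c '' {Q ∈ S | β Q = b}, ?_,
    fun b => hS.image hsub hvol fun Q hQ => hQ.1, fun f g => ?_⟩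
  · rintro b _ ⟨Q, ⟨-, rfl⟩, rfl⟩
    exact hgrid Q
  set G : Cube d → ℝ≥0∞ := fun R => (∏ j, avg (f j) 1 R) * ∫⁻ x in R.set, ofFn g x with hG
  obtain ⟨E, hE, hdisj⟩ := hS
  have hterm (Q : S) : (∏ j, avg (f j) 1 Q.1) * avg g 1 Q.1 * volume Q.1.set ≤
      (6 ^ d) ^ m * G (c Q) := by
    rw [mul_assoc, avg_one_mul_volume]
    calc (∏ j, avg (f j) 1 Q.1) * ∫⁻ x in Q.1.set, ofFn g x
        ≤ (∏ j, 6 ^ d * avg (f j) 1 (c Q)) * ∫⁻ x in (c Q).set, ofFn g x := by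
          gcongr with j
          · exact avg_one_le_of_subset (hsub Q) (hvol Q)
          · exact hsub Q
      _ = _ := by
          rw [Finset.prod_mul_distrib, Finset.prod_const, Finset.card_univ, Fintype.card_fin,
            mul_assoc]
  have hfib (b : Fin d → Bool) (R : Cube d) :
      ∑' Q : (fun Q : S => (β Q, c Q)) ⁻¹' {(b, R)}, G (c Q.1) ≤
        2 * 6 ^ d * (c '' {Q ∈ S | β Q = b}).indicator G R := by
    have hmem (Q : (fun Q : S => (β Q, c Q)) ⁻¹' {(b, R)}) : β Q.1 = b ∧ c Q.1 = R :=
      Prod.mk.inj Q.2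
    by_cases hR : R ∈ c '' {Q ∈ S | β Q = b}
    · rw [indicator_of_mem hR]
      calc ∑' Q : (fun Q : S => (β Q, c Q)) ⁻¹' {(b, R)}, G (c Q.1)
          = (∑' _ : (fun Q : S => (β Q, c Q)) ⁻¹' {(b, R)}, 1) * G R := by
            rw [← ENNReal.tsum_mul_right]
            exact tsum_congr fun Q => by rw [(hmem Q).2, one_mul]
        _ ≤ 2 * 6 ^ d * G R := by
            gcongr
            refine tsum_one_le_of_disjoint (fun Q => Q.1.1) (fun Q => E Q.1.1) R
              (fun Q => ?_) (fun Q => ?_) (fun Q => (hE _ Q.1.2).1) (fun Q => (hE _ Q.1.2).2.1)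
              (fun Q => ?_) (fun Q Q' hne => hdisj Q.1.2 Q'.1.2 fun h => hne ?_)
            · simpa only [(hmem Q).2] using hsub Q.1.1
            · simpa only [(hmem Q).2] using hvol Q.1.1
            · have := (hE _ Q.1.2).2.2
              rw [one_div, ofReal_inv_of_pos two_pos, ENNReal.inv_mul_le_iff (by simp) (by simp)]
                at this
              simpa using this
            · exact Subtype.ext (Subtype.ext h)
    · rw [indicator_of_notMem hR, mul_zero, nonpos_iff_eq_zero, ENNReal.tsum_eq_zero]
      intro Q
      exact absurd ⟨Q.1, ⟨Q.1.2, (hmem Q).1⟩, (hmem Q).2⟩ hR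
  calc sparseForm S f g ≤ ∑' Q : S, (6 ^ d) ^ m * G (c Q) := ENNReal.tsum_le_tsum hterm
    _ = (6 ^ d) ^ m * ∑' Q : S, G (c Q) := ENNReal.tsum_mul_left
    _ = (6 ^ d) ^ m * ∑' (x : (Fin d → Bool) × Cube d),
          ∑' Q : (fun Q : S => (β Q, c Q)) ⁻¹' {x}, G (c Q.1) := by
        rw [ENNReal.tsum_fiberwise (fun Q : S => G (c Q)) (fun Q : S => (β Q, c Q))]
    _ ≤ (6 ^ d) ^ m * ∑' (x : (Fin d → Bool) × Cube d),
          2 * 6 ^ d * (c '' {Q ∈ S | β Q = x.1}).indicator G x.2 := by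
        gcongr with x
        exact hfib x.1 x.2
    _ = _ := by
        rw [ENNReal.tsum_mul_left, ENNReal.tsum_prod', tsum_fintype, ← mul_assoc]
        exact congrArg _ ((Finset.sum_congr rfl fun b _ => (tsum_subtype _ G).symm))

theorem lintegral_Ioi_ofReal_rpow_neg {r s : ℝ} (hr : 1 < r) (hs : 0 < s) :
    ∫⁻ t in Ioi s, ENNReal.ofReal (t ^ (-r)) = ENNReal.ofReal (s ^ (1 - r) / (r - 1)) := by
  rw [← ofReal_integral_eq_lintegral_ofReal (integrableOn_Ioi_rpow_of_lt (by linarith) hs),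
    integral_Ioi_rpow_of_lt (by linarith) hs]
  · congr 1
    rw [show -r + 1 = -(r - 1) by ring, neg_div_neg_eq]
    congr 2; ring
  · filter_upwards [ae_restrict_mem measurableSet_Ioi] with t ht
    exact Real.rpow_nonneg (hs.le.trans (le_of_lt ht)) _

theorem measure_eq_top_eq_zero_of_weak {α : Type*} [MeasurableSpace α] {μ : Measure α}
    {h : α → ℝ≥0∞} {r : ℝ} (hr : 0 < r) {B : ℝ≥0∞} (hB : B ≠ ∞)
    (hweak : ∀ t : ℝ, 0 < t → μ {x | ENNReal.ofReal t < h x} ≤ (B / ENNReal.ofReal t) ^ r) :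
    μ {x | h x = ∞} = 0 := by
  have hlim : Filter.Tendsto (fun n : ℕ => (B * ((n + 1 : ℕ) : ℝ≥0∞)⁻¹) ^ r) Filter.atTop
      (nhds 0) := by
    have h1 := ENNReal.Tendsto.const_mul (a := B)
      ((Filter.tendsto_add_atTop_iff_nat 1).2 ENNReal.tendsto_inv_nat_nhds_zero) (Or.inr hB)
    have h2 := (ENNReal.continuous_rpow_const (y := r)).tendsto _ |>.comp h1
    simpa [Function.comp_def, ENNReal.zero_rpow_of_pos hr] using h2
  refine nonpos_iff_eq_zero.1 (ge_of_tendsto' hlim fun n => ?_)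
  have h1 := hweak (n + 1 : ℕ) (by positivity)
  rw [ofReal_natCast, div_eq_mul_inv] at h1
  refine (measure_mono fun x (hx : h x = ∞) => ?_).trans h1
  change _ < h x
  rw [hx]
  exact natCast_lt_top _

theorem lintegral_le_of_weak_aux {α : Type*} [MeasurableSpace α] {μ : Measure α}
    {h : α → ℝ≥0∞} (hh : Measurable h) {r : ℝ} (hr : 1 < r) {b : ℝ} (hb : 0 < b)
    (hweak : ∀ t : ℝ, 0 < t →
      μ {x | ENNReal.ofReal t < h x} ≤ (ENNReal.ofReal b / ENNReal.ofReal t) ^ r)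
    {s : ℝ} (hs : 0 < s) :
    ∫⁻ x, h x ∂μ ≤ μ univ * ENNReal.ofReal s +
      ENNReal.ofReal (b ^ r * (s ^ (1 - r) / (r - 1))) := by
  have hfin : ∀ᵐ x ∂μ, h x ≠ ∞ := by
    simpa [ae_iff] using measure_eq_top_eq_zero_of_weak (by linarith) ofReal_ne_top hweak
  calc ∫⁻ x, h x ∂μ = ∫⁻ x, ENNReal.ofReal (h x).toReal ∂μ :=
        lintegral_congr_ae (hfin.mono fun x hx => (ofReal_toReal hx).symm)
    _ = ∫⁻ t in Ioi 0, μ {x | t < (h x).toReal} :=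
        lintegral_eq_lintegral_meas_lt μ (.of_forall fun _ => toReal_nonneg)
          hh.ennreal_toReal.aemeasurable
    _ ≤ (∫⁻ t in Ioc 0 s, μ {x | t < (h x).toReal}) +
          ∫⁻ t in Ioi s, μ {x | t < (h x).toReal} := by
        rw [← Ioc_union_Ioi_eq_Ioi hs.le]
        exact lintegral_union_le _ _ _
    _ ≤ (∫⁻ _ in Ioc 0 s, μ univ) +
          ∫⁻ t in Ioi s, ENNReal.ofReal (b ^ r) * ENNReal.ofReal (t ^ (-r)) := by
        gcongr ?_ + ?_
        · exact lintegral_mono fun t => measure_mono (subset_univ _)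
        · refine setLIntegral_mono' measurableSet_Ioi fun t (ht : s < t) => ?_
          have ht0 : 0 < t := hs.trans ht
          calc μ {x | t < (h x).toReal} ≤ μ {x | ENNReal.ofReal t < h x} :=
                measure_mono fun x hx => (lt_ofReal_iff_toReal_lt ofReal_ne_top).2 (by
                  simpa [toReal_ofReal ht0.le] using hx) |>.trans_le ofReal_toReal_le
            _ ≤ (ENNReal.ofReal b / ENNReal.ofReal t) ^ r := hweak t ht0
            _ = ENNReal.ofReal (b ^ r) * ENNReal.ofReal (t ^ (-r)) := by
                rw [← ofReal_div_of_pos ht0, ofReal_rpow_of_pos (by positivity),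
                  ← ofReal_mul (by positivity), Real.div_rpow hb.le ht0.le, Real.rpow_neg ht0.le,
                  div_eq_mul_inv]
    _ = _ := by
        rw [lintegral_const_mul' _ _ ofReal_ne_top, lintegral_Ioi_ofReal_rpow_neg hr hs,
          ← ofReal_mul (by positivity)]
        simp

/-- Kolmogorov's inequality: weak `L^r` embeds into `L^1` on finite measure spaces for `r > 1`. -/
theorem lintegral_le_of_weak {α : Type*} [MeasurableSpace α] {μ : Measure α} [IsFiniteMeasure μ]
    {h : α → ℝ≥0∞} (hh : Measurable h) {r : ℝ} (hr : 1 < r) {B : ℝ≥0∞} (hB : B ≠ ∞)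
    (hweak : ∀ t : ℝ, 0 < t → μ {x | ENNReal.ofReal t < h x} ≤ (B / ENNReal.ofReal t) ^ r) :
    ∫⁻ x, h x ∂μ ≤ ENNReal.ofReal (1 - 1 / r)⁻¹ * B * μ univ ^ (1 - 1 / r) := by
  have hr0 : 0 < r := by linarith
  have hr1 : 0 < 1 - 1 / r := by
    rw [sub_pos, div_lt_one hr0]; exact hr
  rcases eq_or_ne μ 0 with rfl | hμ
  · simp
  have hM : 0 < μ.real univ := by
    simpa [measureReal_def, toReal_pos_iff, pos_iff_ne_zero] using hμ
  have hMμ : μ univ = ENNReal.ofReal (μ.real univ) := by simp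
  have key : ∀ b : ℝ, B.toReal < b →
      ∫⁻ x, h x ∂μ ≤ ENNReal.ofReal (1 - 1 / r)⁻¹ * ENNReal.ofReal b * μ univ ^ (1 - 1 / r) := by
    intro b hb
    have hb0 : 0 < b := toReal_nonneg.trans_lt hb
    refine (lintegral_le_of_weak_aux hh hr hb0 (fun t ht => (hweak t ht).trans ?_)
      (s := b * μ.real univ ^ (-(1 / r))) (by positivity)).trans (le_of_eq ?_)
    · gcongr
      exact le_ofReal_iff_toReal_le hB hb0.le |>.2 hb.le
    · have hr1' : 0 < r - 1 := by linarith
      rw [hMμ, ofReal_rpow_of_pos hM, ← ofReal_mul hM.le, ← ofReal_mul (by positivity),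
        ← ofReal_mul (by positivity), ← ofReal_add (by positivity) (by positivity)]
      congr 1
      set M := μ.real univ
      have e1 : M * M ^ (-(1 / r)) = M ^ (1 - 1 / r) := by
        rw [sub_eq_add_neg, Real.rpow_add hM, Real.rpow_one]
      have e2 : b ^ r * (b * M ^ (-(1 / r))) ^ (1 - r) = b * M ^ (1 - 1 / r) := by
        rw [Real.mul_rpow hb0.le (by positivity), ← Real.rpow_mul hM.le, ← mul_assoc,
          ← Real.rpow_add hb0]
        congr 1
        · simp
        · congr 1; field_simp; ring
      rw [mul_left_comm, e1, ← mul_div_assoc, e2]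
      generalize M ^ (1 - 1 / r) = X
      field_simp
      ring
  have hlim : Filter.Tendsto (fun b : ℝ =>
      ENNReal.ofReal (1 - 1 / r)⁻¹ * ENNReal.ofReal b * μ univ ^ (1 - 1 / r))
      (nhdsWithin B.toReal (Ioi B.toReal))
      (nhds (ENNReal.ofReal (1 - 1 / r)⁻¹ * B * μ univ ^ (1 - 1 / r))) := by
    have h1 : Filter.Tendsto ENNReal.ofReal (nhdsWithin B.toReal (Ioi B.toReal)) (nhds B) := by
      have := (ENNReal.continuous_ofReal.tendsto B.toReal).mono_left
        (nhdsWithin_le_nhds (s := Ioi B.toReal))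
      rwa [ofReal_toReal hB] at this
    have h2 := ENNReal.Tendsto.const_mul (a := ENNReal.ofReal (1 - 1 / r)⁻¹) h1
      (Or.inr ofReal_ne_top)
    exact ENNReal.Tendsto.mul_const h2
      (Or.inr (rpow_ne_top_of_nonneg hr1.le (measure_ne_top _ _)))
  exact ge_of_tendsto hlim (eventually_nhdsWithin_of_forall key)

theorem ofFn_eq_enorm (f : Rd d → ℝ) : ofFn f = fun x => ‖f x‖ₑ :=
  funext fun x => (Real.enorm_eq_ofReal_abs (f x)).symm

theorem eLpNorm_restrict_cube (f : Rd d → ℝ) {q : ℝ≥0∞} (hq : q ≠ 0) (Q : Cube d) :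
    eLpNorm f q (volume.restrict Q.set) = avgE f q Q * volume Q.set ^ (q⁻¹).toReal := by
  rcases eq_or_ne q ∞ with rfl | hq'
  · simp [avgE, ofFn_eq_enorm, eLpNormEssSup]
  · rw [avgE, if_neg hq', avg, eAvg, eLpNorm_eq_lintegral_rpow_enorm_toReal hq hq', ofFn_eq_enorm,
      toReal_inv, ← one_div (q.toReal), ← ENNReal.mul_rpow_of_nonneg _ _ (by positivity),
      mul_right_comm,
      ENNReal.inv_mul_cancel Q.volume_set_ne_zero Q.volume_set_ne_top, one_mul]

theorem inv_add_inv_conj {q : ℝ≥0∞} (hq : 1 ≤ q) : q⁻¹ + (conj q)⁻¹ = 1 := by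
  rw [conj, inv_inv]
  exact add_tsub_cancel_of_le (ENNReal.inv_le_one.2 hq)

theorem conj_ne_zero (q : ℝ≥0∞) : conj q ≠ 0 := by
  simp [conj]

theorem toReal_inv_conj {q : ℝ≥0∞} (hq : 1 ≤ q) :
    ((conj q)⁻¹).toReal = 1 - (q⁻¹).toReal := by
  rw [conj, inv_inv, toReal_sub_of_le (ENNReal.inv_le_one.2 hq) one_ne_top, toReal_one]

theorem setLIntegral_ofFn_le {w : Rd d → ℝ} (hw : IsWeight w) {f : Rd d → ℝ} (hf : Measurable f)
    {q : ℝ≥0∞} (hq : 1 ≤ q) {Q P : Cube d} (hQP : Q.set ⊆ P.set) :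
    ∫⁻ x in Q.set, ofFn f x ≤ eLpNorm (fun x => f x * w x) q (volume.restrict Q.set) *
      (avgE (fun x => (w x)⁻¹) (conj q) P * volume P.set ^ (1 - (q⁻¹).toReal)) := by
  have hwm : AEStronglyMeasurable w volume := hw.1.aestronglyMeasurable
  have hwinv : AEStronglyMeasurable (fun x => (w x)⁻¹) volume :=
    hwm.aemeasurable.inv.aestronglyMeasurable
  have : HolderTriple q (conj q) 1 := ⟨by simpa using inv_add_inv_conj hq⟩
  rw [← toReal_inv_conj hq, ← eLpNorm_restrict_cube _ (conj_ne_zero q), ofFn_eq_enorm,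
    ← eLpNorm_one_eq_lintegral_enorm]
  calc eLpNorm f 1 (volume.restrict Q.set)
      = eLpNorm ((fun x => f x * w x) • fun x => (w x)⁻¹) 1 (volume.restrict Q.set) := by
        refine eLpNorm_congr_ae (ae_restrict_of_ae (hw.2.mono fun x hx => ?_))
        simp [hx.ne']
    _ ≤ _ := eLpNorm_smul_le_mul_eLpNorm hwinv.restrict
        (hf.aestronglyMeasurable.mul hwm).restrict
    _ ≤ _ := by
        gcongr

theorem sum_toReal_inv {p : Fin m → ℝ≥0∞} (hp : ∀ j, 1 ≤ p j) {p0 : ℝ≥0∞}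
    (hp0 : p0⁻¹ = ∑ j, (p j)⁻¹) : ∑ j, ((p j)⁻¹).toReal = 1 / p0.toReal := by
  rw [one_div, ← toReal_inv, hp0,
    toReal_sum fun j _ => ((ENNReal.inv_le_one.2 (hp j)).trans_lt one_lt_top).ne]

theorem rpow_sum {ι : Type*} {a : ℝ≥0∞} (ha : a ≠ 0) (ha' : a ≠ ∞) (s : Finset ι) (r : ι → ℝ) :
    a ^ (∑ i ∈ s, r i) = ∏ i ∈ s, a ^ r i := by
  classical
  induction s using Finset.induction_on with
  | empty => simp
  | insert i s hi ih => rw [Finset.sum_insert hi, Finset.prod_insert hi, rpow_add _ _ ha ha', ih]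

/-- The density `w^p`. -/
def powDensity (p0 : ℝ) (w : Fin m → Rd d → ℝ) : Rd d → ℝ≥0∞ :=
  fun x => ENNReal.ofReal (prodW w x) ^ p0

theorem powDensity_mul_prod_avg_le {w : Fin m → Rd d → ℝ} (hw : ∀ j, IsWeight (w j))
    {f : Fin m → Rd d → ℝ} (hf : ∀ j, Measurable (f j)) {p : Fin m → ℝ≥0∞} (hp : ∀ j, 1 ≤ p j)
    {p0 : ℝ} (hp0 : 0 < p0) (hp0p : ∑ j, ((p j)⁻¹).toReal = 1 / p0)
    {Q P : Cube d} (hQP : Q.set ⊆ P.set) {K : ℝ≥0∞} (hK : volume P.set ≤ K * volume Q.set) :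
    (∫⁻ x in P.set, powDensity p0 w x) ^ (1 / p0) * ∏ j, avg (f j) 1 Q ≤
      K ^ m * AP p0 p w *
        ∏ j, eLpNorm (fun x => f j x * w j x) (p j) (volume.restrict Q.set) := by
  have hP0 := P.volume_set_ne_zero
  have hPt := P.volume_set_ne_top
  have h1 : (∫⁻ x in P.set, powDensity p0 w x) ^ (1 / p0) ≤
      avg (prodW w) p0 P * volume P.set ^ (1 / p0) := by
    rw [avg, eAvg, ← ENNReal.mul_rpow_of_nonneg _ _ (by positivity), mul_right_comm,
      ENNReal.inv_mul_cancel hP0 hPt, one_mul]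
    gcongr with x
    exact ENNReal.rpow_le_rpow (ofReal_le_ofReal (le_abs_self _)) hp0.le
  have h2 (j : Fin m) : avg (f j) 1 Q ≤
      K * (avgE (fun x => (w j x)⁻¹) (conj (p j)) P *
        eLpNorm (fun x => f j x * w j x) (p j) (volume.restrict Q.set)) *
          volume P.set ^ (-((p j)⁻¹).toReal) := by
    rw [avg_one]
    calc (volume Q.set)⁻¹ * ∫⁻ x in Q.set, ofFn (f j) x
        ≤ (K * (volume P.set)⁻¹) * _ :=
          mul_le_mul' (inv_volume_le_of_volume_le hK)
            (setLIntegral_ofFn_le (hw j) (hf j) (hp j) hQP)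
      _ = _ := by
          rw [sub_eq_add_neg, ENNReal.rpow_add _ _ hP0 hPt, ENNReal.rpow_one]
          calc _ = ((volume P.set)⁻¹ * volume P.set) *
                (K * (avgE (fun x => (w j x)⁻¹) (conj (p j)) P *
                  eLpNorm (fun x => f j x * w j x) (p j) (volume.restrict Q.set)) *
                  volume P.set ^ (-((p j)⁻¹).toReal)) := by ring
            _ = _ := by rw [ENNReal.inv_mul_cancel hP0 hPt, one_mul]
  have h3 : ∏ j, volume P.set ^ (-((p j)⁻¹).toReal) = volume P.set ^ (-(1 / p0)) := by
    rw [← hp0p, ← Finset.sum_neg_distrib, rpow_sum hP0 hPt]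
  calc _ ≤ (avg (prodW w) p0 P * volume P.set ^ (1 / p0)) *
        ∏ j, (K * (avgE (fun x => (w j x)⁻¹) (conj (p j)) P *
        eLpNorm (fun x => f j x * w j x) (p j) (volume.restrict Q.set)) *
          volume P.set ^ (-((p j)⁻¹).toReal)) := by
        gcongr with j
        exact h2 j
    _ = (volume P.set ^ (1 / p0) * volume P.set ^ (-(1 / p0))) *
        (K ^ m * (avg (prodW w) p0 P * ∏ j, avgE (fun x => (w j x)⁻¹) (conj (p j)) P) *
        ∏ j, eLpNorm (fun x => f j x * w j x) (p j) (volume.restrict Q.set)) := by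
        simp only [Finset.prod_mul_distrib, h3, Finset.prod_const, Finset.card_univ,
          Fintype.card_fin]
        ring
    _ ≤ _ := by
        rw [← ENNReal.rpow_add _ _ hP0 hPt, add_neg_cancel, ENNReal.rpow_zero, one_mul]
        gcongr
        exact le_iSup (fun Q : Cube d => avg (prodW w) p0 Q *
          ∏ j, avgE (fun x => (w j x)⁻¹) (conj (p j)) Q) P

theorem tsum_prod_eLpNorm_le {α ι : Type*} [MeasurableSpace α] {μ : Measure α} [Countable ι]
    {A : ι → Set α} (hA : ∀ i, MeasurableSet (A i)) (hdisj : Pairwise (Function.onFun Disjoint A))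
    (F : Fin m → α → ℝ) {p : Fin m → ℝ≥0∞} (hp : ∀ j, 1 ≤ p j)
    {p0 : ℝ} (hp0 : 0 < p0) (hp0p : ∑ j, ((p j)⁻¹).toReal = 1 / p0) :
    ∑' i, (∏ j, eLpNorm (F j) (p j) (μ.restrict (A i))) ^ p0 ≤
      (∏ j, eLpNorm (F j) (p j) μ) ^ p0 := by
  classical
  let _ : MeasurableSpace ι := ⊤
  have hp' (j) : p j ≠ 0 := (one_pos.trans_le (hp j)).ne'
  set r : Fin m → ℝ := fun j => p0 * ((p j)⁻¹).toReal with hr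
  have hr0 (j) : 0 ≤ r j := by positivity
  have hr1 : ∑ j, r j = 1 := by
    rw [← Finset.mul_sum, hp0p]; field_simp
  set D : Fin m → ℝ≥0∞ := fun j => if p j = ∞ then eLpNorm (F j) (p j) μ ^ p0 else 1 with hD
  have hrtop (j) (h : p j = ∞) : r j = 0 := by simp [hr, h]
  have hfin (j) (h : p j ≠ ∞) (ν : Measure α) :
      eLpNorm (F j) (p j) ν ^ p0 = (∫⁻ x, ‖F j x‖ₑ ^ (p j).toReal ∂ν) ^ r j := by
    rw [eLpNorm_eq_lintegral_rpow_enorm_toReal (hp' j) h, ← ENNReal.rpow_mul, mul_comm]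
    simp [hr]
  have hloc (i) (j) : eLpNorm (F j) (p j) (μ.restrict (A i)) ^ p0 ≤
      D j * (∫⁻ x in A i, ‖F j x‖ₑ ^ (p j).toReal ∂μ) ^ r j := by
    by_cases h : p j = ∞
    · simp only [hD, if_pos h, hrtop j h, ENNReal.rpow_zero, mul_one]
      gcongr
      exact Measure.restrict_le_self
    · simp only [hD, if_neg h, one_mul, hfin j h, le_refl]
  calc ∑' i, (∏ j, eLpNorm (F j) (p j) (μ.restrict (A i))) ^ p0
      ≤ ∑' i, ∏ j, D j * (∫⁻ x in A i, ‖F j x‖ₑ ^ (p j).toReal ∂μ) ^ r j := by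
        gcongr with i
        rw [← ENNReal.prod_rpow_of_nonneg hp0.le]
        exact Finset.prod_le_prod' fun j _ => hloc i j
    _ = (∏ j, D j) * ∑' i, ∏ j, (∫⁻ x in A i, ‖F j x‖ₑ ^ (p j).toReal ∂μ) ^ r j := by
        simp_rw [Finset.prod_mul_distrib]
        rw [ENNReal.tsum_mul_left]
    _ ≤ (∏ j, D j) * ∏ j, (∑' i, ∫⁻ x in A i, ‖F j x‖ₑ ^ (p j).toReal ∂μ) ^ r j := by
        gcongr
        simp_rw [← lintegral_count]
        exact ENNReal.lintegral_prod_norm_pow_le _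
          (fun j _ => (measurable_of_countable _).aemeasurable) hr1
          fun j _ => hr0 j
    _ ≤ (∏ j, D j) * ∏ j, (∫⁻ x, ‖F j x‖ₑ ^ (p j).toReal ∂μ) ^ r j := by
        gcongr with j
        rw [← lintegral_iUnion hA hdisj]
        exact setLIntegral_le_lintegral _ _
    _ = (∏ j, eLpNorm (F j) (p j) μ) ^ p0 := by
        rw [← ENNReal.prod_rpow_of_nonneg hp0.le, ← Finset.prod_mul_distrib]
        refine Finset.prod_congr rfl fun j _ => ?_
        by_cases h : p j = ∞
        · simp only [hD, if_pos h, hrtop j h, ENNReal.rpow_zero, mul_one]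
        · simp only [hD, if_neg h, one_mul, hfin j h]

theorem BCS.lintegral_ofFn_ne_top {f : Rd d → ℝ} (hf : BCS f) : ∫⁻ x, ofFn f x ≠ ∞ := by
  obtain ⟨-, ⟨C, hC⟩, hsupp⟩ := hf
  have hle : ∫⁻ x, ofFn f x ≤ ENNReal.ofReal C * volume (tsupport f) := by
    rw [← setLIntegral_const,
      ← lintegral_indicator (isClosed_tsupport f).measurableSet]
    refine lintegral_mono fun x => ?_
    by_cases hx : x ∈ tsupport f
    · rw [indicator_of_mem hx]
      exact ofReal_le_ofReal (hC x)
    · simp [ofFn, image_eq_zero_of_notMem_tsupport hx]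
  exact ne_top_of_le_ne_top (mul_ne_top ofReal_ne_top hsupp.measure_lt_top.ne) hle

theorem BCS.avg_le {f : Rd d → ℝ} (hf : BCS f) : ∃ C : ℝ≥0∞, C ≠ ∞ ∧ ∀ Q, avg f 1 Q ≤ C := by
  obtain ⟨-, ⟨C, hC⟩, -⟩ := hf
  refine ⟨ENNReal.ofReal C, ofReal_ne_top, fun Q => ?_⟩
  rw [avg_one]
  calc (volume Q.set)⁻¹ * ∫⁻ x in Q.set, ofFn f x
      ≤ (volume Q.set)⁻¹ * ∫⁻ _ in Q.set, ENNReal.ofReal C := by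
        gcongr with x
        exact ofReal_le_ofReal (hC x)
    _ = ENNReal.ofReal C := by
        rw [setLIntegral_const, mul_left_comm,
          ENNReal.inv_mul_cancel Q.volume_set_ne_zero Q.volume_set_ne_top, mul_one]

theorem exists_side_bound (hd : 1 ≤ d) (hm : 1 ≤ m) {f : Fin m → Rd d → ℝ} (hf : ∀ j, BCS (f j))
    {l : ℝ≥0∞} (hl : l ≠ 0) : ∃ R : ℝ, ∀ Q : Cube d, l < ∏ j, avg (f j) 1 Q → Q.side ≤ R := by
  set I : ℝ≥0∞ := ∏ j, ∫⁻ x, ofFn (f j) x with hI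
  have hItop : I ≠ ∞ := prod_ne_top fun j _ => (hf j).lintegral_ofFn_ne_top
  refine ⟨max 1 (I / l).toReal, fun Q hQ => ?_⟩
  rcases le_or_gt Q.side 1 with h1 | h1
  · exact h1.trans (le_max_left _ _)
  have hV0 : volume Q.set ^ m ≠ 0 := pow_ne_zero _ Q.volume_set_ne_zero
  have hVt : volume Q.set ^ m ≠ ∞ := pow_ne_top Q.volume_set_ne_top
  have h2 : l * volume Q.set ^ m ≤ I := by
    calc l * volume Q.set ^ m ≤ (∏ j, avg (f j) 1 Q) * volume Q.set ^ m := by gcongr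
      _ = ∏ j, (avg (f j) 1 Q * volume Q.set) := by
        rw [Finset.prod_mul_distrib, Finset.prod_const, Finset.card_univ, Fintype.card_fin]
      _ ≤ I := Finset.prod_le_prod' fun j _ => by
        rw [avg_one_mul_volume]
        exact setLIntegral_le_lintegral _ _
  have h3 : volume Q.set ^ m ≤ I / l := by
    rw [ENNReal.le_div_iff_mul_le (Or.inl hl) (Or.inr hItop), mul_comm]
    exact h2
  have h4 : Q.side ^ (d * m) ≤ (I / l).toReal := by
    have := toReal_mono (div_ne_top hItop hl) h3
    rwa [Q.volume_set, ← pow_mul, toReal_pow, toReal_ofReal Q.side_pos.le] at this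
  exact ((le_self_pow₀ h1.le (by positivity)).trans h4).trans (le_max_right _ _)

/-- The concentric cube with five times the side length. -/
def Cube.dilate (Q : Cube d) : Cube d :=
  ⟨fun i => Q.corner i - 2 * Q.side, 5 * Q.side, by linarith [Q.side_pos]⟩

theorem Cube.subset_dilate {Q R : Cube d} (h : (R.set ∩ Q.set).Nonempty)
    (hside : R.side ≤ 2 * Q.side) : R.set ⊆ Q.dilate.set := by
  obtain ⟨y, hyR, hyQ⟩ := h
  intro x hx i
  have h1 := hyR i
  have h2 := hyQ i
  have h3 := hx i
  simp only [Cube.dilate]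
  constructor <;> linarith

theorem Cube.set_nonempty (Q : Cube d) : Q.set.Nonempty :=
  ⟨Q.corner, fun i => ⟨le_rfl, by linarith [Q.side_pos]⟩⟩

/-- The weak-type bound for the multilinear maximal operator: the cubes on which the product of
averages exceeds `l` are covered by a set of small weighted measure. -/
theorem exists_cover_large_avg (hd : 1 ≤ d) (hm : 1 ≤ m) {w : Fin m → Rd d → ℝ}
    (hw : ∀ j, IsWeight (w j)) {f : Fin m → Rd d → ℝ} (hf : ∀ j, BCS (f j))
    {p : Fin m → ℝ≥0∞} (hp : ∀ j, 1 ≤ p j) {p0 : ℝ} (hp0 : 0 < p0)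
    (hp0p : ∑ j, ((p j)⁻¹).toReal = 1 / p0) {l : ℝ≥0∞} (hl : l ≠ 0) (hl' : l ≠ ∞) :
    ∃ Ω : Set (Rd d), MeasurableSet Ω ∧ (∀ Q : Cube d, l < ∏ j, avg (f j) 1 Q → Q.set ⊆ Ω) ∧
      ∫⁻ x in Ω, powDensity p0 w x ≤
        ((5 ^ d) ^ m * AP p0 p w * (∏ j, LpW (w j) (p j) (f j)) / l) ^ p0 := by
  obtain ⟨R, hR⟩ := exists_side_bound hd hm hf hl
  obtain ⟨u, hut, hdisj, hcov⟩ := Vitali.exists_disjoint_subfamily_covering_enlargement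
    Cube.set {Q : Cube d | l < ∏ j, avg (f j) 1 Q} Cube.side 2 one_lt_two
    (fun Q _ => Q.side_pos.le) R hR (fun Q _ => Q.set_nonempty)
  have hdisj' : Pairwise (Function.onFun Disjoint fun Q : u => Q.1.set) := fun Q Q' h =>
    hdisj Q.2 Q'.2 fun h' => h (Subtype.ext h')
  have hcount : Countable u := by
    have := Measure.countable_meas_pos_of_disjoint_iUnion (μ := volume)
      (fun Q : u => Q.1.measurableSet_set) hdisj'
    rw [show {Q : u | 0 < volume Q.1.set} = univ from
      eq_univ_of_forall fun Q => pos_iff_ne_zero.2 Q.1.volume_set_ne_zero] at this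
    exact countable_univ_iff.1 this
  refine ⟨⋃ Q : u, Q.1.dilate.set, .iUnion fun Q => Q.1.dilate.measurableSet_set,
    fun Q hQ => ?_, ?_⟩
  · obtain ⟨b, hb, hne, hside⟩ := hcov Q hQ
    exact (Cube.subset_dilate hne hside).trans (subset_iUnion (fun Q : u => Q.1.dilate.set) ⟨b, hb⟩)
  have hloc (Q : u) : ∫⁻ x in Q.1.dilate.set, powDensity p0 w x ≤
      ((5 ^ d) ^ m * AP p0 p w / l) ^ p0 *
        (∏ j, eLpNorm (fun x => f j x * w j x) (p j) (volume.restrict Q.1.set)) ^ p0 := by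
    have h1 := powDensity_mul_prod_avg_le hw (fun j => (hf j).1) hp hp0 hp0p (Q := Q.1)
      (P := Q.1.dilate) (K := 5 ^ d)
      (Cube.subset_dilate (by simpa using Q.1.set_nonempty) (by linarith [Q.1.side_pos]))
      (Cube.volume_set_le_of_side_le (k := 5) (by simp [Cube.dilate]))
    have h2 : (∫⁻ x in Q.1.dilate.set, powDensity p0 w x) ^ (1 / p0) ≤
        (5 ^ d) ^ m * AP p0 p w / l *
          ∏ j, eLpNorm (fun x => f j x * w j x) (p j) (volume.restrict Q.1.set) := by
      rw [← ENNReal.mul_div_right_comm,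
        ENNReal.le_div_iff_mul_le (Or.inl hl) (Or.inl hl')]
      exact le_trans (by gcongr; exact (hut Q.2).le) h1
    rw [← ENNReal.mul_rpow_of_nonneg _ _ hp0.le]
    calc _ = ((∫⁻ x in Q.1.dilate.set, powDensity p0 w x) ^ (1 / p0)) ^ p0 := by
          rw [← ENNReal.rpow_mul, one_div_mul_cancel hp0.ne', ENNReal.rpow_one]
      _ ≤ _ := by gcongr
  calc _ ≤ ∑' Q : u, ∫⁻ x in Q.1.dilate.set, powDensity p0 w x := lintegral_iUnion_le _ _
    _ ≤ ∑' Q : u, ((5 ^ d) ^ m * AP p0 p w / l) ^ p0 *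
        (∏ j, eLpNorm (fun x => f j x * w j x) (p j) (volume.restrict Q.1.set)) ^ p0 :=
        ENNReal.tsum_le_tsum hloc
    _ ≤ ((5 ^ d) ^ m * AP p0 p w / l) ^ p0 * (∏ j, LpW (w j) (p j) (f j)) ^ p0 := by
        rw [ENNReal.tsum_mul_left]
        gcongr
        exact tsum_prod_eLpNorm_le (fun Q : u => Q.1.measurableSet_set) hdisj'
          (fun j x => f j x * w j x) hp hp0 hp0p
    _ = _ := by
        rw [← ENNReal.mul_rpow_of_nonneg _ _ hp0.le, ← ENNReal.mul_div_right_comm]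

theorem avgE_ne_zero {u : Rd d → ℝ} (hu : AEStronglyMeasurable u volume)
    (hpos : ∀ᵐ x, 0 < u x) {q : ℝ≥0∞} (hq : q ≠ 0) (Q : Cube d) : avgE u q Q ≠ 0 := by
  intro h
  have h1 := eLpNorm_restrict_cube u hq Q
  rw [h, zero_mul, eLpNorm_eq_zero_iff hu.restrict hq] at h1
  have h2 : ∀ᵐ _ ∂(volume.restrict Q.set), False := by
    filter_upwards [h1, ae_restrict_of_ae hpos] with x hx hx'
    exact hx'.ne' hx
  rw [ae_iff] at h2
  simp [Q.volume_set_ne_zero] at h2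

theorem prodW_pos {w : Fin m → Rd d → ℝ} (hw : ∀ j, IsWeight (w j)) : ∀ᵐ x, 0 < prodW w x := by
  filter_upwards [ae_all_iff.2 fun j => (hw j).2] with x hx
  exact Finset.prod_pos fun j _ => hx j

theorem aemeasurable_prodW {w : Fin m → Rd d → ℝ} (hw : ∀ j, IsWeight (w j)) :
    AEMeasurable (prodW w) volume :=
  Finset.aemeasurable_fun_prod _ fun j _ => (hw j).1.aestronglyMeasurable.aemeasurable

theorem AP_ne_zero {w : Fin m → Rd d → ℝ} (hw : ∀ j, IsWeight (w j)) {p0 : ℝ} (hp0 : 0 < p0)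
    (p : Fin m → ℝ≥0∞) : AP p0 p w ≠ 0 := by
  set Q : Cube d := ⟨0, 1, one_pos⟩
  have h1 : avg (prodW w) p0 Q ≠ 0 := by
    have := avgE_ne_zero (aemeasurable_prodW hw).aestronglyMeasurable (prodW_pos hw)
      (q := ENNReal.ofReal p0) (by simpa using hp0) Q
    rwa [avgE, if_neg ofReal_ne_top, toReal_ofReal hp0.le] at this
  have h2 : ∏ j, avgE (fun x => (w j x)⁻¹) (conj (p j)) Q ≠ 0 :=
    Finset.prod_ne_zero_iff.2 fun j _ =>
      avgE_ne_zero (hw j).1.aestronglyMeasurable.aemeasurable.inv.aestronglyMeasurable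
        ((hw j).2.mono fun x hx => inv_pos.2 hx) (conj_ne_zero _) Q
  intro h
  rw [AP, APtw, iSup_eq_zero] at h
  exact mul_ne_zero h1 h2 (h Q)

theorem tsum_prod_avg_mul_le {S : Set (Cube d)} (hS : S.Countable) (f : Fin m → Rd d → ℝ)
    {ν : Measure (Rd d)} [IsFiniteMeasure ν] {θ p0 : ℝ} (hθ : 0 < θ) (hθ1 : θ ≤ 1) (hθp : θ < p0)
    {l B : ℝ≥0∞} (hl : ∀ Q : Cube d, ν Q.set ≠ 0 → ∏ j, avg (f j) 1 Q ≤ l) (hB : B ≠ ∞)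
    (hweak : ∀ s : ℝ, 0 < s →
      ν {x | ENNReal.ofReal s < ASparsePow S θ f x} ≤ (B / ENNReal.ofReal s) ^ p0) :
    ∑' R : S, (∏ j, avg (f j) 1 R.1) * ν R.1.set ≤
      l ^ (1 - θ) * (ENNReal.ofReal (1 - θ / p0)⁻¹ * B ^ θ * ν univ ^ (1 - θ / p0)) := by
  have := hS.to_subtype
  set h : Rd d → ℝ≥0∞ := fun x => ∑' Q : S, (∏ j, avg (f j) 1 Q.1) ^ θ *
      (Q.1).set.indicator (fun _ => (1 : ℝ≥0∞)) x with hh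
  have hmeas (Q : S) : Measurable fun x => (∏ j, avg (f j) 1 Q.1) ^ θ *
      (Q.1).set.indicator (fun _ => (1 : ℝ≥0∞)) x :=
    (measurable_const.indicator Q.1.measurableSet_set).const_mul _
  have hterm (Q : S) : (∏ j, avg (f j) 1 Q.1) * ν Q.1.set ≤
      l ^ (1 - θ) * ∫⁻ x, (∏ j, avg (f j) 1 Q.1) ^ θ *
        (Q.1).set.indicator (fun _ => (1 : ℝ≥0∞)) x ∂ν := by
    rw [lintegral_const_mul _ (measurable_const.indicator Q.1.measurableSet_set),
      lintegral_indicator Q.1.measurableSet_set, setLIntegral_one, ← mul_assoc]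
    rcases eq_or_ne (ν Q.1.set) 0 with h0 | h0
    · simp [h0]
    · gcongr
      calc ∏ j, avg (f j) 1 Q.1
          = (∏ j, avg (f j) 1 Q.1) ^ (1 - θ) * (∏ j, avg (f j) 1 Q.1) ^ θ := by
            rw [← ENNReal.rpow_add_of_nonneg _ _ (by linarith) hθ.le, sub_add_cancel,
              ENNReal.rpow_one]
        _ ≤ _ := by
            gcongr
            exact hl _ h0
  have hkol : ∫⁻ x, h x ∂ν ≤
      ENNReal.ofReal (1 - θ / p0)⁻¹ * B ^ θ * ν univ ^ (1 - θ / p0) := by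
    have hr : 1 < p0 / θ := (one_lt_div hθ).2 hθp
    have := lintegral_le_of_weak (μ := ν) (h := h) (Measurable.tsum hmeas) hr
      (B := B ^ θ) (rpow_ne_top_of_nonneg hθ.le hB) fun t ht => ?_
    · simpa only [one_div_div] using this
    · have hst : ENNReal.ofReal (t ^ (1 / θ)) ^ θ = ENNReal.ofReal t := by
        rw [ofReal_rpow_of_nonneg (by positivity) hθ.le, ← Real.rpow_mul ht.le,
          one_div_mul_cancel hθ.ne', Real.rpow_one]
      refine le_trans (measure_mono fun x hx => ?_) ((hweak (t ^ (1 / θ)) (by positivity)).trans ?_)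
      · change _ < h x ^ (1 / θ)
        rw [one_div, ENNReal.lt_rpow_inv_iff hθ, ← one_div, hst]
        exact hx
      · rw [← hst, ← ENNReal.div_rpow_of_nonneg _ _ hθ.le, ← ENNReal.rpow_mul,
          mul_div_cancel₀ _ hθ.ne']
  calc _ ≤ ∑' Q : S, l ^ (1 - θ) * ∫⁻ x, (∏ j, avg (f j) 1 Q.1) ^ θ *
        (Q.1).set.indicator (fun _ => (1 : ℝ≥0∞)) x ∂ν := ENNReal.tsum_le_tsum hterm
    _ = l ^ (1 - θ) * ∫⁻ x, h x ∂ν := by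
        rw [ENNReal.tsum_mul_left, hh, lintegral_tsum fun Q => (hmeas Q).aemeasurable]
    _ ≤ _ := by gcongr

/-- A nonnegative measurable version of the product weight. -/
theorem exists_measurable_version {w : Fin m → Rd d → ℝ} (hw : ∀ j, IsWeight (w j)) :
    ∃ u : Rd d → ℝ, Measurable u ∧ (∀ x, 0 ≤ u x) ∧ u =ᵐ[volume] prodW w := by
  refine ⟨fun x => max ((aemeasurable_prodW hw).mk (prodW w) x) 0,
    (aemeasurable_prodW hw).measurable_mk.max measurable_const, fun x => le_max_right _ _, ?_⟩
  filter_upwards [(aemeasurable_prodW hw).ae_eq_mk, prodW_pos hw] with x h1 h2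
  rw [← h1, max_eq_left h2.le]

theorem withDensity_apply_eq {w : Fin m → Rd d → ℝ} {u : Rd d → ℝ} (hu : u =ᵐ[volume] prodW w)
    (p0 : ℝ) (A : Set (Rd d)) :
    volume.withDensity (fun x => ENNReal.ofReal (u x) ^ p0) A =
      ∫⁻ x in A, powDensity p0 w x := by
  rw [withDensity_apply' _ A]
  refine lintegral_congr_ae (ae_restrict_of_ae (hu.mono fun x hx => ?_))
  simp [powDensity, hx]

theorem le_div_rpow_of_eWeakNorm_le {w : Fin m → Rd d → ℝ} {p0 : ℝ} (hp0 : 0 < p0)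
    {h : Rd d → ℝ≥0∞} {B : ℝ≥0∞} (hB : eWeakNorm (prodW w) p0 h ≤ B) {s : ℝ} (hs : 0 < s) :
    ∫⁻ x in {x | ENNReal.ofReal s < h x}, powDensity p0 w x ≤ (B / ENNReal.ofReal s) ^ p0 := by
  have h1 : ENNReal.ofReal s *
      (∫⁻ x in {x | ENNReal.ofReal s < h x}, powDensity p0 w x) ^ (1 / p0) ≤ B :=
    le_trans (le_iSup₂ (f := fun (l : ℝ) (_ : 0 < l) => ENNReal.ofReal l *
      (∫⁻ x in {x | ENNReal.ofReal l < h x}, ENNReal.ofReal (prodW w x) ^ p0) ^ (1 / p0)) s hs) hB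
  rw [← ENNReal.rpow_inv_le_iff hp0, ← one_div,
    ENNReal.le_div_iff_mul_le (Or.inl (by simpa using hs))
    (Or.inl ofReal_ne_top), mul_comm]
  exact h1

/-- The dualized estimate for an operator satisfying sparse form domination. -/
theorem SparseFormDom.mul_measure_le {T : (Fin m → Rd d → ℝ) → Rd d → ℝ} {CT : ℝ≥0∞}
    (hT : SparseFormDom T CT) {w : Fin m → Rd d → ℝ} {p0 θ : ℝ} (hθ : 0 < θ) (hθ1 : θ ≤ 1)
    (hθp : θ < p0) {f : Fin m → Rd d → ℝ} (hf : ∀ j, BCS (f j)) {B : ℝ≥0∞} (hB : B ≠ ∞)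
    (hA : ∀ (β : Fin d → Bool) (S : Set (Cube d)), S ⊆ dyadicGrid d (gridShift β) →
      IsSparse ((2 * 6 ^ d : ℝ))⁻¹ S → eWeakNorm (prodW w) p0 (ASparsePow S θ f) ≤ B)
    {u : Rd d → ℝ} (hum : Measurable u) (hu0 : ∀ x, 0 ≤ u x) (hu : u =ᵐ[volume] prodW w)
    {μ : Measure (Rd d)} (hμ : μ = volume.withDensity fun x => ENNReal.ofReal (u x) ^ p0)
    {F : Set (Rd d)} (hF : MeasurableSet F) (hμF : μ F ≠ ∞) {n : ℕ}
    (hFn : F ⊆ Metric.closedBall 0 n) (hun : ∀ x ∈ F, u x ≤ n)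
    {l : ℝ≥0∞} (hl : ∀ Q : Cube d, (Q.set ∩ F).Nonempty → ∏ j, avg (f j) 1 Q ≤ l)
    {t : ℝ≥0∞} (ht : ∀ x ∈ F, t ≤ ofFn (T f) x) :
    t * μ F ≤ CT * ((6 ^ d) ^ m * (2 * 6 ^ d) * (2 ^ d *
      (l ^ (1 - θ) * (ENNReal.ofReal (1 - θ / p0)⁻¹ * B ^ θ * μ F ^ (1 - θ / p0))))) := by
  have hp0 : 0 < p0 := hθ.trans hθp
  set U : Rd d → ℝ≥0∞ := fun x => ENNReal.ofReal (u x) ^ p0 with hU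
  have hUm : Measurable U := hum.ennreal_ofReal.pow_const _
  set g : Rd d → ℝ := F.indicator fun x => u x ^ p0 with hg
  have hgU : ofFn g = F.indicator U := by
    funext x
    by_cases hx : x ∈ F
    · simp [ofFn, hg, hx, hU, abs_of_nonneg (Real.rpow_nonneg (hu0 x) p0),
        ofReal_rpow_of_nonneg (hu0 x) hp0.le]
    · simp [ofFn, hg, hx]
  have hgB : BCS g := by
    refine ⟨(hum.pow_const _).indicator hF, ⟨(n : ℝ) ^ p0, fun x => ?_⟩, ?_⟩
    · by_cases hx : x ∈ F
      · rw [hg, indicator_of_mem hx, abs_of_nonneg (Real.rpow_nonneg (hu0 x) p0)]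
        exact Real.rpow_le_rpow (hu0 x) (hun x hx) hp0.le
      · rw [hg, indicator_of_notMem hx, abs_zero]
        positivity
    · refine HasCompactSupport.intro (isCompact_closedBall (0 : Rd d) n) fun x hx => ?_
      exact indicator_of_notMem (fun h => hx (hFn h)) _
  have hgint (A : Set (Rd d)) (hA : MeasurableSet A) : ∫⁻ x in A, ofFn g x = μ.restrict F A := by
    rw [hgU, lintegral_indicator hF, Measure.restrict_restrict hF, Measure.restrict_apply hA, hμ,
      withDensity_apply _ (hA.inter hF), inter_comm]
  have : IsFiniteMeasure (μ.restrict F) := ⟨by simpa using hμF.lt_top⟩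
  obtain ⟨S, hS, hdom⟩ := hT f g hf hgB
  obtain ⟨𝒮, hgrid, hsparse, hform⟩ := exists_dyadic_sparse (m := m) hS
  have hβ (β : Fin d → Bool) :
      ∑' R : 𝒮 β, (∏ j, avg (f j) 1 R.1) * ∫⁻ x in R.1.set, ofFn g x ≤
        l ^ (1 - θ) * (ENNReal.ofReal (1 - θ / p0)⁻¹ * B ^ θ * μ F ^ (1 - θ / p0)) := by
    have h1 := tsum_prod_avg_mul_le (ν := μ.restrict F) (S := 𝒮 β)
      ((countable_dyadicGrid _).mono (hgrid β)) f hθ hθ1 hθp (l := l) (B := B)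
      (fun Q hQ => hl Q ?_) hB fun s hs => ?_
    · rw [Measure.restrict_apply_univ] at h1
      refine le_trans (le_of_eq (tsum_congr fun R => ?_)) h1
      rw [hgint _ R.1.measurableSet_set]
    · rw [Measure.restrict_apply Q.measurableSet_set] at hQ
      exact nonempty_of_measure_ne_zero hQ
    · refine (Measure.restrict_apply_le _ _).trans ?_
      rw [hμ, withDensity_apply_eq hu]
      exact le_div_rpow_of_eWeakNorm_le hp0 (hA β _ (hgrid β) (hsparse β)) hs
  calc t * μ F = ∫⁻ x, t * ofFn g x := by
        rw [lintegral_const_mul _ (by rw [hgU]; exact hUm.indicator hF), ← setLIntegral_univ,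
          hgint _ .univ, Measure.restrict_apply_univ]
    _ ≤ ∫⁻ x, ofFn (T f) x * ofFn g x := by
        refine lintegral_mono fun x => ?_
        by_cases hx : x ∈ F
        · exact mul_le_mul_left (ht x hx) _
        · simp [hgU, hx]
    _ ≤ CT * sparseForm S f g := hdom
    _ ≤ CT * ((6 ^ d) ^ m * (2 * 6 ^ d) * ∑ _β : Fin d → Bool,
        l ^ (1 - θ) * (ENNReal.ofReal (1 - θ / p0)⁻¹ * B ^ θ * μ F ^ (1 - θ / p0))) := by
        refine mul_le_mul_right ((hform f g).trans ?_) _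
        gcongr with β
        exact hβ β
    _ = _ := by simp

theorem mul_rpow_le_of_mul_half_le {t M X K Y : ℝ≥0∞} (hM : M ≠ 0) (hM' : M ≠ ∞) {p θ : ℝ}
    (hp : 0 < p) (hθ : 0 ≤ θ) (hθ1 : θ ≤ 1)
    (h : t * (M / 2) ≤ X * ((K * (2 / M) ^ (1 / p)) ^ (1 - θ) * (Y * M ^ (1 - θ / p)))) :
    t * M ^ (1 / p) ≤ 2 * 2 ^ (1 / p) * X * (K ^ (1 - θ) * Y) := by
  have hθ' : 0 ≤ 1 - θ := by linarith
  have h2 : ((2 : ℝ≥0∞) ^ (1 / p)) ^ (1 - θ) ≤ 2 ^ (1 / p) := by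
    conv_rhs => rw [← ENNReal.rpow_one (2 ^ (1 / p))]
    exact ENNReal.rpow_le_rpow_of_exponent_le (ENNReal.one_le_rpow one_le_two (by positivity))
      (by linarith)
  have hMpow : (M⁻¹ ^ (1 / p)) ^ (1 - θ) * M ^ (1 - θ / p) * M ^ (1 / p - 1) = 1 := by
    rw [ENNReal.inv_rpow, ← ENNReal.rpow_neg, ← ENNReal.rpow_mul, ← ENNReal.rpow_add _ _ hM hM',
      ← ENNReal.rpow_add _ _ hM hM']
    convert ENNReal.rpow_zero using 2
    field_simp
    ring
  calc t * M ^ (1 / p) = 2 * (t * (M / 2)) * M ^ (1 / p - 1) := by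
        rw [mul_left_comm, ENNReal.mul_div_cancel two_ne_zero ofNat_ne_top, mul_assoc]
        congr 1
        nth_rewrite 2 [← ENNReal.rpow_one M]
        rw [← ENNReal.rpow_add _ _ hM hM', add_sub_cancel]
    _ ≤ 2 * (X * ((K * (2 / M) ^ (1 / p)) ^ (1 - θ) * (Y * M ^ (1 - θ / p)))) *
          M ^ (1 / p - 1) := by gcongr
    _ = 2 * (((2 : ℝ≥0∞) ^ (1 / p)) ^ (1 - θ)) * X * (K ^ (1 - θ) * Y) *
          ((M⁻¹ ^ (1 / p)) ^ (1 - θ) * M ^ (1 - θ / p) * M ^ (1 / p - 1)) := by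
        rw [div_eq_mul_inv 2 M, ENNReal.mul_rpow_of_nonneg _ _ (by positivity : 0 ≤ 1 / p),
          ENNReal.mul_rpow_of_nonneg _ _ hθ', ENNReal.mul_rpow_of_nonneg _ _ hθ']
        ring
    _ ≤ _ := by
        rw [hMpow, mul_one]
        gcongr

/-- The constant of the weak-type bound. -/
def weakConst (d m : ℕ) (CT : ℝ≥0∞) (p0 : ℝ) : ℝ≥0∞ :=
  2 * 2 ^ (1 / p0) * ((CT + 1) * ((6 ^ d) ^ m * (2 * 6 ^ d) * 2 ^ d)) * (5 ^ d) ^ m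

theorem weakConst_ne_top {CT : ℝ≥0∞} (hCT : CT ≠ ∞) {p0 : ℝ} (hp0 : 0 < p0) :
    weakConst d m CT p0 ≠ ∞ := by
  have : (2 : ℝ≥0∞) ^ (1 / p0) ≠ ∞ := rpow_ne_top_of_nonneg (by positivity) ofNat_ne_top
  unfold weakConst
  finiteness

theorem weakConst_ne_zero {CT : ℝ≥0∞} {p0 : ℝ} : weakConst d m CT p0 ≠ 0 := by
  simp [weakConst]

theorem measure_ne_top_of_bounded {u : Rd d → ℝ} {p0 : ℝ} (hp0 : 0 ≤ p0) {μ : Measure (Rd d)}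
    (hμ : μ = volume.withDensity fun x => ENNReal.ofReal (u x) ^ p0) {E : Set (Rd d)} {n : ℕ}
    (hEn : E ⊆ Metric.closedBall 0 n) (hun : ∀ x ∈ E, u x ≤ n) : μ E ≠ ∞ := by
  have hvol : volume E ≠ ∞ :=
    ne_top_of_le_ne_top (isCompact_closedBall (0 : Rd d) n).measure_lt_top.ne (measure_mono hEn)
  rw [hμ, withDensity_apply' _ E]
  refine ne_top_of_le_ne_top
    (b := ∫⁻ _ in E, ENNReal.ofReal n ^ p0) ?_ (setLIntegral_mono measurable_const fun x hx => ?_)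
  · rw [setLIntegral_const]
    exact mul_ne_top (rpow_ne_top_of_nonneg hp0 ofReal_ne_top) hvol
  · exact ENNReal.rpow_le_rpow (ofReal_le_ofReal (hun x hx)) hp0

theorem SparseFormDom.mul_measure_rpow_le (hd : 1 ≤ d) (hm : 1 ≤ m)
    {T : (Fin m → Rd d → ℝ) → Rd d → ℝ} {CT : ℝ≥0∞} (hT : SparseFormDom T CT)
    {p : Fin m → ℝ≥0∞} (hp : ∀ j, 1 ≤ p j) {p0 θ : ℝ}
    (hp0p : ∑ j, ((p j)⁻¹).toReal = 1 / p0)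
    {w : Fin m → Rd d → ℝ} (hw : ∀ j, IsWeight (w j)) (hAP : AP p0 p w ≠ ∞)
    (hθ : 0 < θ) (hθ1 : θ ≤ 1) (hθp : θ < p0) {f : Fin m → Rd d → ℝ} (hf : ∀ j, BCS (f j))
    {N : ℝ≥0∞} (hN : N ≠ ∞)
    (hA : ∀ (β : Fin d → Bool) (S : Set (Cube d)), S ⊆ dyadicGrid d (gridShift β) →
      IsSparse ((2 * 6 ^ d : ℝ))⁻¹ S →
        eWeakNorm (prodW w) p0 (ASparsePow S θ f) ≤ N * ∏ j, LpW (w j) (p j) (f j))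
    {u : Rd d → ℝ} (hum : Measurable u) (hu0 : ∀ x, 0 ≤ u x) (hu : u =ᵐ[volume] prodW w)
    {μ : Measure (Rd d)} (hμ : μ = volume.withDensity fun x => ENNReal.ofReal (u x) ^ p0)
    {E : Set (Rd d)} (hE : MeasurableSet E) {n : ℕ}
    (hEn : E ⊆ Metric.closedBall 0 n) (hun : ∀ x ∈ E, u x ≤ n)
    {t : ℝ≥0∞} (ht : ∀ x ∈ E, t ≤ ofFn (T f) x) :
    t * μ E ^ (1 / p0) ≤ weakConst d m CT p0 * ENNReal.ofReal (1 - θ / p0)⁻¹ *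
      AP p0 p w ^ (1 - θ) * N ^ θ * ∏ j, LpW (w j) (p j) (f j) := by
  have hp0 : 0 < p0 := hθ.trans hθp
  have hθ' : 0 ≤ 1 - θ := by linarith
  set P := ∏ j, LpW (w j) (p j) (f j) with hP
  have hμE : μ E ≠ ∞ := measure_ne_top_of_bounded hp0.le hμ hEn hun
  have hAP0 : AP p0 p w ≠ 0 := AP_ne_zero hw hp0 p
  rcases eq_or_ne (μ E) 0 with hM | hM
  · rw [hM, ENNReal.zero_rpow_of_pos (by positivity), mul_zero]
    exact zero_le
  rcases eq_or_ne P ∞ with hPt | hPt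
  · rcases eq_or_ne N 0 with hN0 | hN0
    · choose C hC hCle using fun j => (hf j).avg_le
      have := hT.mul_measure_le hθ hθ1 hθp hf (B := 0) zero_ne_top
        (fun β S h1 h2 => by simpa [hN0] using hA β S h1 h2) hum hu0 hu hμ hE hμE hEn hun
        (l := ∏ j, C j) (fun Q _ => Finset.prod_le_prod' fun j _ => hCle j Q) ht
      rw [ENNReal.zero_rpow_of_pos hθ, mul_zero, zero_mul, mul_zero, mul_zero, mul_zero,
        mul_zero, nonpos_iff_eq_zero, mul_eq_zero, or_iff_left hM] at this
      rw [this, zero_mul]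
      exact zero_le
    · rw [hPt, mul_top]
      · exact le_top
      · have h1 : 0 < 1 - θ / p0 := sub_pos.2 ((div_lt_one hp0).2 hθp)
        have h2 : AP p0 p w ^ (1 - θ) ≠ 0 :=
          (ENNReal.rpow_pos (pos_iff_ne_zero.2 hAP0) hAP).ne'
        have h3 : N ^ θ ≠ 0 := (ENNReal.rpow_pos (pos_iff_ne_zero.2 hN0) hN).ne'
        have h4 : ENNReal.ofReal (1 - θ / p0)⁻¹ ≠ 0 := by simpa using h1
        exact mul_ne_zero (mul_ne_zero (mul_ne_zero weakConst_ne_zero h4) h2) h3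
  set M := μ E with hMdef
  set K := (5 ^ d) ^ m * AP p0 p w * P with hK
  have hKt : K ≠ ∞ := by finiteness
  have h2M : (2 / M) ^ (1 / p0) ≠ 0 :=
    (ENNReal.rpow_pos (ENNReal.div_pos two_ne_zero hμE) (div_ne_top ofNat_ne_top hM)).ne'
  have h2Mt : (2 / M) ^ (1 / p0) ≠ ∞ :=
    rpow_ne_top_of_nonneg (by positivity) (div_ne_top ofNat_ne_top hM)
  obtain ⟨l, hl0, hlt, hlK, hlle⟩ : ∃ l : ℝ≥0∞, l ≠ 0 ∧ l ≠ ∞ ∧ (K / l) ^ p0 ≤ M / 2 ∧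
      l ^ (1 - θ) * (N * P) ^ θ ≤ (K * (2 / M) ^ (1 / p0)) ^ (1 - θ) * (N * P) ^ θ := by
    rcases eq_or_ne K 0 with hK0 | hK0
    · have hP0 : P = 0 := by simpa [hK, hAP0] using hK0
      refine ⟨1, one_ne_zero, one_ne_top, ?_, ?_⟩
      · rw [hK0, ENNReal.zero_div, ENNReal.zero_rpow_of_pos hp0]
        exact zero_le
      · rw [hP0, mul_zero, ENNReal.zero_rpow_of_pos hθ, mul_zero, mul_zero]
    · refine ⟨K * (2 / M) ^ (1 / p0), mul_ne_zero hK0 h2M, mul_ne_top hKt h2Mt, ?_, le_rfl⟩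
      have hdiv := ENNReal.mul_div_mul_left 1 ((2 / M) ^ (1 / p0)) hK0 hKt
      rw [mul_one] at hdiv
      rw [hdiv, one_div ((2 / M) ^ (1 / p0)), ENNReal.inv_rpow, ← ENNReal.rpow_mul,
        one_div_mul_cancel hp0.ne', ENNReal.rpow_one,
        ENNReal.inv_div (Or.inl hμE) (Or.inl hM)]
  obtain ⟨Ω, hΩ, hΩcov, hΩle⟩ := exists_cover_large_avg hd hm hw hf hp hp0 hp0p hl0 hlt
  rw [← withDensity_apply_eq hu, ← hμ] at hΩle
  have hFle : μ (E \ Ω) ≤ M := measure_mono sdiff_subset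
  have hleF : M / 2 ≤ μ (E \ Ω) := by
    have h1 : M ≤ M / 2 + μ (E \ Ω) := by
      calc M ≤ μ (Ω ∪ E \ Ω) := measure_mono fun x hx => by
            by_cases h : x ∈ Ω <;> simp [h, hx]
        _ ≤ μ Ω + μ (E \ Ω) := measure_union_le _ _
        _ ≤ _ := by gcongr; exact hΩle.trans hlK
    nth_rewrite 1 [← ENNReal.add_halves M] at h1
    exact (ENNReal.add_le_add_iff_left (div_ne_top hμE two_ne_zero)).1 h1
  have hmain := hT.mul_measure_le hθ hθ1 hθp hf (mul_ne_top hN hPt) hA hum hu0 hu hμ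
    (hE.diff hΩ) (ne_top_of_le_ne_top hμE hFle) (sdiff_subset.trans hEn)
    (fun x hx => hun x hx.1) (l := l) (fun Q hQ => ?_) fun x hx => ht x hx.1
  · have hexp : 0 ≤ 1 - θ / p0 := sub_nonneg.2 ((div_le_one hp0).2 hθp.le)
    set X : ℝ≥0∞ := (CT + 1) * ((6 ^ d) ^ m * (2 * 6 ^ d) * 2 ^ d) with hX
    set J : ℝ≥0∞ := ENNReal.ofReal (1 - θ / p0)⁻¹
    have hhalf : t * (M / 2) ≤ X * ((K * (2 / M) ^ (1 / p0)) ^ (1 - θ) *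
        ((J * (N * P) ^ θ) * M ^ (1 - θ / p0))) := by
      calc t * (M / 2) ≤ t * μ (E \ Ω) := by gcongr
        _ ≤ _ := hmain
        _ ≤ (CT + 1) * ((6 ^ d) ^ m * (2 * 6 ^ d) * (2 ^ d *
            (l ^ (1 - θ) * (J * (N * P) ^ θ * M ^ (1 - θ / p0))))) := by
          gcongr
          exact le_self_add
        _ = X * (l ^ (1 - θ) * (N * P) ^ θ) * (J * M ^ (1 - θ / p0)) := by rw [hX]; ring
        _ ≤ X * ((K * (2 / M) ^ (1 / p0)) ^ (1 - θ) * (N * P) ^ θ) *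
            (J * M ^ (1 - θ / p0)) := by gcongr
        _ = _ := by ring
    refine (mul_rpow_le_of_mul_half_le hM hμE hp0 hθ.le hθ1 hhalf).trans ?_
    have h5 : (((5 : ℝ≥0∞) ^ d) ^ m) ^ (1 - θ) ≤ (5 ^ d) ^ m := by
      conv_rhs => rw [← ENNReal.rpow_one ((5 ^ d) ^ m)]
      exact ENNReal.rpow_le_rpow_of_exponent_le
        (one_le_pow₀ (one_le_pow₀ (by norm_num))) (by linarith)
    have hPP : P ^ (1 - θ) * P ^ θ = P := by
      rw [← ENNReal.rpow_add_of_nonneg _ _ hθ' hθ.le, sub_add_cancel, ENNReal.rpow_one]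
    calc 2 * 2 ^ (1 / p0) * X * (K ^ (1 - θ) * (J * (N * P) ^ θ))
        = 2 * 2 ^ (1 / p0) * X * (((5 : ℝ≥0∞) ^ d) ^ m) ^ (1 - θ) * J * AP p0 p w ^ (1 - θ) *
          N ^ θ * (P ^ (1 - θ) * P ^ θ) := by
          rw [hK, ENNReal.mul_rpow_of_nonneg _ _ hθ', ENNReal.mul_rpow_of_nonneg _ _ hθ',
            ENNReal.mul_rpow_of_nonneg _ _ hθ.le]
          ring
      _ ≤ _ := by
          rw [hPP, weakConst, ← hX]
          gcongr
  · by_contra! hlt'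
    obtain ⟨x, hxQ, hxF⟩ := hQ
    exact hxF.2 (hΩcov Q hlt' hxQ)

/-- Linearization: the weak-type norm of `T` is controlled by that of `A^θ_S`. -/
theorem stmt8 (d m : ℕ) (hd : 1 ≤ d) (hm : 1 ≤ m)
    (p : Fin m → ℝ≥0∞) (hp : ∀ j, 1 ≤ p j)
    (p0 : ℝ≥0∞) (hp0top : p0 ≠ ∞) (hp0 : p0⁻¹ = ∑ j, (p j)⁻¹)
    (CT : ℝ≥0∞) (hCT : CT ≠ ∞) :
    ∃ c : ℝ≥0∞, c ≠ ∞ ∧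
      ∀ (T : (Fin m → Rd d → ℝ) → Rd d → ℝ),
        (∀ f, Measurable (T f)) → SparseFormDom T CT →
        ∀ w : Fin m → Rd d → ℝ, (∀ j, IsWeight (w j)) →
          AP p0.toReal p w ≠ ∞ →
          ∀ θ : ℝ, 0 < θ → θ ≤ 1 → θ < p0.toReal →
          ∀ N : ℝ≥0∞, N ≠ ∞ →
          (∀ D : Set (Cube d), IsDyadicGrid D →
            ∀ S : Set (Cube d), S ⊆ D → IsSparse ((2 * 6 ^ d : ℝ))⁻¹ S →
              ∀ f : Fin m → Rd d → ℝ, (∀ j, BCS (f j)) →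
                eWeakNorm (prodW w) p0.toReal (ASparsePow S θ f) ≤
                  N * ∏ j, LpW (w j) (p j) (f j)) →
          ∀ f : Fin m → Rd d → ℝ, (∀ j, BCS (f j)) →
            weakNorm (prodW w) p0.toReal (T f) ≤
              c * ENNReal.ofReal (1 - θ / p0.toReal)⁻¹ *
                AP p0.toReal p w ^ (1 - θ) * N ^ θ *
                ∏ j, LpW (w j) (p j) (f j) := by
  rcases le_or_gt p0.toReal 0 with hneg | hpos
  · exact ⟨0, zero_ne_top, fun _ _ _ _ _ _ θ hθ _ hθp => absurd hθp (by linarith)⟩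
  refine ⟨weakConst d m CT p0.toReal, weakConst_ne_top hCT hpos, ?_⟩
  intro T hTm hT w hw hAP θ hθ hθ1 hθp N hN hA f hf
  obtain ⟨u, hum, hu0, hu⟩ := exists_measurable_version hw
  set q := p0.toReal
  set μ : Measure (Rd d) := volume.withDensity fun x => ENNReal.ofReal (u x) ^ q with hμ
  refine iSup₂_le fun l hl => ?_
  set E : Set (Rd d) := {x | ENNReal.ofReal l < ofFn (T f) x} with hE
  have hEm : MeasurableSet E := measurableSet_lt measurable_const (hTm f).abs.ennreal_ofReal
  have hμE : ∫⁻ x in E, ENNReal.ofReal (prodW w x) ^ q = μ E := (withDensity_apply_eq hu q E).symm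
  rw [hμE]
  set s : ℕ → Set (Rd d) := fun n => E ∩ (Metric.closedBall 0 n ∩ {x | u x ≤ n}) with hs
  have hmono : Monotone s := fun n k hnk => by
    have hnk' : (n : ℝ) ≤ k := by exact_mod_cast hnk
    exact inter_subset_inter_right _ (inter_subset_inter (Metric.closedBall_subset_closedBall hnk')
      fun x hx => le_trans hx hnk')
  have hunion : ⋃ n, s n = E := by
    refine Subset.antisymm (iUnion_subset fun n => inter_subset_left) fun x hx => ?_
    obtain ⟨n, hn⟩ := exists_nat_ge (max ‖x‖ (u x))
    exact mem_iUnion.2 ⟨n, hx, by simpa using (le_max_left _ _).trans hn,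
      (le_max_right _ _).trans hn⟩
  have hlim := ENNReal.Tendsto.const_mul (a := ENNReal.ofReal l)
    ((tendsto_measure_iUnion_atTop (μ := μ) hmono).ennrpow_const (1 / q)) (Or.inr ofReal_ne_top)
  rw [hunion] at hlim
  refine le_of_tendsto' hlim fun n => ?_
  exact hT.mul_measure_rpow_le hd hm hp (sum_toReal_inv hp hp0) hw hAP hθ hθ1 hθp hf hN
    (fun β S h1 h2 => hA _ (isDyadicGrid_gridShift β) S h1 h2 f hf) hum hu0 hu hμ
    (hEm.inter (measurableSet_closedBall.inter (measurableSet_le hum measurable_const)))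
    (fun x hx => hx.2.1) (fun x hx => hx.2.2) fun x hx => le_of_lt hx.1

end Paper
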